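/- arXiv:1405.2781 — 2 statements merged into one kernel-verified Lean document; each statement's English description precedes it below -/
import Mathlib

section
/- Fix α ∈ (0,1) and p ≥ 1. Assume Y = m₁(X) + m₂(X)ε where X is an ℝ^d-valued random vector independent of the real random variable ε, m₁ : ℝ^d → ℝ and m₂ : ℝ^d → (0,∞) are Lipschitz with constants [m₁]_Lip and [m₂]_Lip, E[|X|^p] < ∞ and E[|ε|^p] < ∞; set [m]_Lip = [m₁]_Lip + [m₂]_Lip·(E[|ε|^p])^{1/p}. Let γ ⊂ ℝ^d be any finite grid whose cells all have positive P_X-mass, let X̃ = Proj_γ(X), and for each grid point c set G̃_a(c) = E[ρ_α(Y−a)·1_{Proj_γ(X)=c}]/P(Proj_γ(X)=c) and G_a(x) = E[ρ_α(m₁(x)+m₂(x)ε − a)]. Then ( E[ ( sup_{a∈ℝ} |G̃_a(X̃) − G_a(X)| )^p ] )^{1/p} ≤ 2·max(α,1−α)·[m]_Lip·( E[|X̃ − X|^p] )^{1/p}. -/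
open MeasureTheory ProbabilityTheory Filter

/-- The `p`-th power `L_p`-quantization error of a measure `μ` on `ℝ^d` for a grid `γ`:
`∫ dist(z,γ)^p dμ(z)`. -/
noncomputable def qErr {d : ℕ} (μ : Measure (EuclideanSpace ℝ (Fin d))) (p : ℝ)
    (γ : Set (EuclideanSpace ℝ (Fin d))) : ℝ :=
  ∫ z, Metric.infDist z γ ^ p ∂μ

/-- `γ` is an `L_p`-optimal `N`-grid for (the law) `μ`: a nonempty set of at most `N` points
minimizing the quantization error among all such grids. -/
def IsOptimalGrid {d : ℕ} (μ : Measure (EuclideanSpace ℝ (Fin d))) (p : ℝ) (N : ℕ)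
    (γ : Finset (EuclideanSpace ℝ (Fin d))) : Prop :=
  γ.Nonempty ∧ γ.card ≤ N ∧
    ∀ γ' : Finset (EuclideanSpace ℝ (Fin d)), γ'.Nonempty → γ'.card ≤ N →
      qErr μ p ↑γ ≤ qErr μ p ↑γ'

/-- `proj` is a measurable nearest-point projection onto the finite grid `γ`. -/
def IsNearestProj {d : ℕ} (γ : Finset (EuclideanSpace ℝ (Fin d)))
    (proj : EuclideanSpace ℝ (Fin d) → EuclideanSpace ℝ (Fin d)) : Prop :=
  Measurable proj ∧ ∀ z, proj z ∈ γ ∧ dist z (proj z) = Metric.infDist z ↑γ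

/-- The (topological) support of a measure on `ℝ^d`: points all of whose neighbourhoods have
positive mass. -/
def msupport {d : ℕ} (μ : Measure (EuclideanSpace ℝ (Fin d))) :
    Set (EuclideanSpace ℝ (Fin d)) :=
  {x | ∀ r > 0, 0 < μ (Metric.ball x r)}

/-- The check (pinball) function `ρ_α(z) = z(α − 1_{z<0})`. -/
noncomputable def checkFn (α z : ℝ) : ℝ := z * (α - if z < 0 then 1 else 0)

/-- `G_a(x) = E[ρ_α(m₁(x)+m₂(x)ε−a)]`. -/
noncomputable def Gfun {d : ℕ} {Ω : Type*} [MeasurableSpace Ω] (P : Measure Ω) (ε : Ω → ℝ)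
    (m₁ m₂ : EuclideanSpace ℝ (Fin d) → ℝ) (α a : ℝ) (x : EuclideanSpace ℝ (Fin d)) : ℝ :=
  ∫ ω, checkFn α (m₁ x + m₂ x * ε ω - a) ∂P

/-- `G̃_a(c) = E[ρ_α(Y−a)·1_{Proj_γ(X)=c}] / P(Proj_γ(X)=c)`, the conditional expectation of
`ρ_α(Y−a)` given that the quantized covariate equals the grid point `c`. -/
noncomputable def Gtil {d : ℕ} {Ω : Type*} [MeasurableSpace Ω] (P : Measure Ω) (Y : Ω → ℝ)
    (X : Ω → EuclideanSpace ℝ (Fin d))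
    (proj : EuclideanSpace ℝ (Fin d) → EuclideanSpace ℝ (Fin d))
    (α a : ℝ) (c : EuclideanSpace ℝ (Fin d)) : ℝ :=
  (∫ ω, Set.indicator {ω' | proj (X ω') = c} (fun ω' => checkFn α (Y ω' - a)) ω ∂P) /
    (P {ω' | proj (X ω') = c}).toReal

theorem aux_checkFn_lip (α : ℝ) (hα : α ∈ Set.Ioo (0:ℝ) 1) (u v : ℝ) :
    |checkFn α u - checkFn α v| ≤ max α (1 - α) * |u - v| := by
  obtain ⟨h0, h1⟩ := hα
  have hM1 := le_max_left α (1 - α)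
  have hM2 := le_max_right α (1 - α)
  generalize max α (1 - α) = M at *
  unfold checkFn
  rw [abs_le]
  rcases abs_cases (u - v) with ⟨h, h'⟩ | ⟨h, h'⟩ <;> rw [h] <;>
    split_ifs with hu hv hv <;> constructor <;> nlinarith

theorem aux_checkFn_meas (α : ℝ) : Measurable (checkFn α) := by
  unfold checkFn
  refine measurable_id.mul (measurable_const.sub ?_)
  exact Measurable.ite measurableSet_Iio measurable_const measurable_const

theorem aux_jensen {Ω : Type*} [MeasurableSpace Ω] (Q : Measure Ω) [IsProbabilityMeasure Q]
    (f : Ω → ℝ) (p : ℝ) (hp : 1 ≤ p) (hf : ∀ ω, 0 ≤ f ω) (hi : Integrable f Q)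
    (hip : Integrable (fun ω => f ω ^ p) Q) :
    (∫ ω, f ω ∂Q) ^ p ≤ ∫ ω, f ω ^ p ∂Q :=
  ConvexOn.map_integral_le (g := fun x : ℝ => x ^ p) (convexOn_rpow hp)
    ((Real.continuous_rpow_const (by linarith)).continuousOn) isClosed_Ici
    (ae_of_all _ hf) hi hip

theorem aux_int_of_pow {Ω : Type*} [MeasurableSpace Ω] (Q : Measure Ω) [IsProbabilityMeasure Q]
    (f : Ω → ℝ) (p : ℝ) (hp : 1 ≤ p) (hf : ∀ ω, 0 ≤ f ω) (hm : Measurable f)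
    (hip : Integrable (fun ω => f ω ^ p) Q) : Integrable f Q := by
  refine Integrable.mono' (hip.add (integrable_const 1)) hm.aestronglyMeasurable
    (ae_of_all _ fun ω => ?_)
  rw [Real.norm_of_nonneg (hf ω)]
  simp only [Pi.add_apply]
  rcases le_total (f ω) 1 with h | h
  · have := Real.rpow_nonneg (hf ω) p
    linarith
  · have := Real.rpow_le_rpow_of_exponent_le h hp
    rw [Real.rpow_one] at this
    linarith

theorem aux_add_pow (a b p : ℝ) (ha : 0 ≤ a) (hb : 0 ≤ b) (hp : 1 ≤ p) :
    (a + b) ^ p ≤ 2 ^ (p - 1) * (a ^ p + b ^ p) := by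
  lift a to NNReal using ha
  lift b to NNReal using hb
  exact_mod_cast NNReal.rpow_add_le_mul_rpow_add_rpow a b hp

theorem aux_Gfun_lip {d : ℕ} (α : ℝ) (hα : α ∈ Set.Ioo (0:ℝ) 1)
    {Ω : Type*} [MeasurableSpace Ω] (P : Measure Ω) [IsProbabilityMeasure P]
    (ε : Ω → ℝ) (hεm : Measurable ε) (hε : Integrable ε P)
    (m₁ m₂ : EuclideanSpace ℝ (Fin d) → ℝ) (K₁ K₂ : NNReal)
    (h₁ : LipschitzWith K₁ m₁) (h₂ : LipschitzWith K₂ m₂) (a : ℝ)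
    (x y : EuclideanSpace ℝ (Fin d)) :
    Integrable (fun ω => checkFn α (m₁ x + m₂ x * ε ω - a)) P ∧
    |Gfun P ε m₁ m₂ α a x - Gfun P ε m₁ m₂ α a y| ≤
      max α (1 - α) * (K₁ + K₂ * ∫ ω, |ε ω| ∂P) * ‖x - y‖ := by
  have hM : 0 ≤ max α (1 - α) := le_max_of_le_left hα.1.le
  have hint : ∀ x, Integrable (fun ω => checkFn α (m₁ x + m₂ x * ε ω - a)) P := by
    intro x
    have h1 : Integrable (fun ω => m₁ x + m₂ x * ε ω - a) P :=
      ((integrable_const _).add (hε.const_mul _)).sub (integrable_const _)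
    refine Integrable.mono' (h1.abs.const_mul (max α (1 - α)))
      ((aux_checkFn_meas α).comp (by fun_prop)).aestronglyMeasurable (ae_of_all _ fun ω => ?_)
    have := aux_checkFn_lip α hα (m₁ x + m₂ x * ε ω - a) 0
    have h0 : checkFn α 0 = 0 := by simp [checkFn]
    rw [h0, sub_zero, sub_zero] at this
    exact this
  refine ⟨hint x, ?_⟩
  unfold Gfun
  rw [← integral_sub (hint x) (hint y)]
  refine (abs_integral_le_integral_abs).trans ?_
  have hr : max α (1 - α) * (K₁ + K₂ * ∫ ω, |ε ω| ∂P) * ‖x - y‖ =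
      ∫ ω, max α (1 - α) * ((K₁ + K₂ * |ε ω|) * ‖x - y‖) ∂P := by
    rw [integral_const_mul, integral_mul_const, integral_add (integrable_const _)
      (hε.abs.const_mul _), integral_const_mul]
    simp
    ring
  rw [hr]
  refine integral_mono ((hint x).sub (hint y)).abs
    ((((integrable_const _).add (hε.abs.const_mul _)).mul_const _).const_mul _) fun ω => ?_
  refine (aux_checkFn_lip α hα _ _).trans (mul_le_mul_of_nonneg_left ?_ hM)
  have e1 : |m₁ x - m₁ y| ≤ K₁ * ‖x - y‖ := by simpa [Real.dist_eq, dist_eq_norm] using h₁.dist_le_mul x y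
  have e2 : |m₂ x - m₂ y| ≤ K₂ * ‖x - y‖ := by simpa [Real.dist_eq, dist_eq_norm] using h₂.dist_le_mul x y
  calc _ = |(m₁ x - m₁ y) + (m₂ x - m₂ y) * ε ω| := by congr 1; ring
    _ ≤ |m₁ x - m₁ y| + |m₂ x - m₂ y| * |ε ω| := by rw [← abs_mul]; exact abs_add_le _ _
    _ ≤ K₁ * ‖x - y‖ + K₂ * ‖x - y‖ * |ε ω| := by gcongr
    _ = _ := by ring

theorem aux_cell {d : ℕ} (α : ℝ) (hα : α ∈ Set.Ioo (0:ℝ) 1)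
    {Ω : Type*} [MeasurableSpace Ω] (P : Measure Ω) [IsProbabilityMeasure P]
    (X : Ω → EuclideanSpace ℝ (Fin d)) (ε : Ω → ℝ) (hXm : Measurable X) (hεm : Measurable ε)
    (hindep : IndepFun X ε P) (hε : Integrable ε P)
    (m₁ m₂ : EuclideanSpace ℝ (Fin d) → ℝ) (K₁ K₂ : NNReal)
    (h₁ : LipschitzWith K₁ m₁) (h₂ : LipschitzWith K₂ m₂)
    (Y : Ω → ℝ) (hY : ∀ ω, Y ω = m₁ (X ω) + m₂ (X ω) * ε ω)
    (proj : EuclideanSpace ℝ (Fin d) → EuclideanSpace ℝ (Fin d)) (hpm : Measurable proj)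
    (c : EuclideanSpace ℝ (Fin d)) (hc : 0 < P {ω | proj (X ω) = c})
    (hXi : Integrable (fun ω => ‖X ω - c‖) P) (a : ℝ) :
    |Gtil P Y X proj α a c - Gfun P ε m₁ m₂ α a c| ≤
      max α (1 - α) * (K₁ + K₂ * ∫ ω, |ε ω| ∂P) *
        ∫ ω, ‖X ω - c‖ ∂(P[|{ω | proj (X ω) = c}]) := by
  have hM : 0 ≤ max α (1 - α) := le_max_of_le_left hα.1.le
  set A : Set Ω := {ω | proj (X ω) = c} with hA
  have hAm : MeasurableSet A := (hpm.comp hXm) (measurableSet_singleton c)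
  have hSm : MeasurableSet {x | proj x = c} := hpm (measurableSet_singleton c)
  set q : ℝ := (P A).toReal with hq
  have hqpos : 0 < q := ENNReal.toReal_pos hc.ne' (measure_ne_top _ _)
  let φ : EuclideanSpace ℝ (Fin d) → ℝ := Set.indicator {x | proj x = c} (fun _ => 1)
  have hφm : Measurable φ := measurable_const.indicator hSm
  have hφA : ∀ (f : Ω → ℝ) ω, φ (X ω) * f ω = A.indicator f ω := by
    intro f ω
    by_cases h : proj (X ω) = c
    · simp [φ, hA, Set.indicator, h]
    · simp [φ, hA, Set.indicator, h]
  have hφ0 : ∀ x, 0 ≤ φ x := fun x => Set.indicator_nonneg (fun _ _ => zero_le_one) x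
  have hφq : ∫ ω, φ (X ω) ∂P = q := by
    have : (fun ω => φ (X ω)) = A.indicator (fun _ => (1:ℝ)) := by
      funext ω; rw [← hφA, mul_one]
    rw [this, integral_indicator hAm]
    simp [hq, Measure.real]
  have hgi := (aux_Gfun_lip α hα P ε hεm hε m₁ m₂ K₁ K₂ h₁ h₂ a c c).1
  have hG : ∫ ω, φ (X ω) * checkFn α (m₁ c + m₂ c * ε ω - a) ∂P =
      q * Gfun P ε m₁ m₂ α a c := by
    rw [← hφq]
    exact IndepFun.integral_fun_mul_eq_mul_integral
      (hindep.comp (φ := φ) (ψ := fun t => checkFn α (m₁ c + m₂ c * t - a)) hφm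
        ((aux_checkFn_meas α).comp (by fun_prop)))
      (hφm.comp hXm).aestronglyMeasurable hgi.aestronglyMeasurable
  have hgi2 : Integrable (fun ω => φ (X ω) * checkFn α (m₁ c + m₂ c * ε ω - a)) P := by
    rw [funext (hφA (fun ω => checkFn α (m₁ c + m₂ c * ε ω - a)))]
    exact hgi.indicator hAm
  have hei : Integrable (fun ω => φ (X ω) * ‖X ω - c‖) P := by
    rw [funext (hφA (fun ω => ‖X ω - c‖))]
    exact hXi.indicator hAm
  have hKi : Integrable (fun ω => (K₁:ℝ) + K₂ * |ε ω|) P :=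
    (integrable_const _).add (hε.abs.const_mul _)
  have hind2 : IndepFun (fun ω => φ (X ω) * ‖X ω - c‖) (fun ω => (K₁:ℝ) + K₂ * |ε ω|) P :=
    hindep.comp (φ := fun x => φ x * ‖x - c‖) (ψ := fun t => (K₁:ℝ) + K₂ * |t|)
      (hφm.mul (by fun_prop)) (by fun_prop)
  have hbi : Integrable (fun ω => max α (1 - α) *
      (φ (X ω) * ‖X ω - c‖ * ((K₁:ℝ) + K₂ * |ε ω|))) P :=
    (hind2.integrable_mul hei hKi).const_mul _
  have hpt : ∀ ω, |φ (X ω) * checkFn α (Y ω - a) -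
      φ (X ω) * checkFn α (m₁ c + m₂ c * ε ω - a)| ≤
      max α (1 - α) * (φ (X ω) * ‖X ω - c‖ * ((K₁:ℝ) + K₂ * |ε ω|)) := by
    intro ω
    rw [← mul_sub, abs_mul, abs_of_nonneg (hφ0 _)]
    have e1 : |m₁ (X ω) - m₁ c| ≤ K₁ * ‖X ω - c‖ := by
      simpa [Real.dist_eq, dist_eq_norm] using h₁.dist_le_mul (X ω) c
    have e2 : |m₂ (X ω) - m₂ c| ≤ K₂ * ‖X ω - c‖ := by
      simpa [Real.dist_eq, dist_eq_norm] using h₂.dist_le_mul (X ω) c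
    have e3 : |(Y ω - a) - (m₁ c + m₂ c * ε ω - a)| ≤ ‖X ω - c‖ * ((K₁:ℝ) + K₂ * |ε ω|) := by
      calc _ = |(m₁ (X ω) - m₁ c) + (m₂ (X ω) - m₂ c) * ε ω| := by
            rw [hY]; congr 1; ring
        _ ≤ |m₁ (X ω) - m₁ c| + |m₂ (X ω) - m₂ c| * |ε ω| := by
            rw [← abs_mul]; exact abs_add_le _ _
        _ ≤ K₁ * ‖X ω - c‖ + K₂ * ‖X ω - c‖ * |ε ω| := by gcongr
        _ = _ := by ring
    calc _ ≤ φ (X ω) * (max α (1 - α) * (‖X ω - c‖ * ((K₁:ℝ) + K₂ * |ε ω|))) := by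
          refine mul_le_mul_of_nonneg_left ?_ (hφ0 _)
          exact (aux_checkFn_lip α hα _ _).trans (mul_le_mul_of_nonneg_left e3 hM)
      _ = _ := by ring
  have hYm : Measurable Y := by
    rw [funext hY]
    exact (h₁.continuous.measurable.comp hXm).add
      ((h₂.continuous.measurable.comp hXm).mul hεm)
  have hdm : Measurable (fun ω => φ (X ω) * checkFn α (Y ω - a)) :=
    (hφm.comp hXm).mul ((aux_checkFn_meas α).comp (hYm.sub_const a))
  have hdi : Integrable (fun ω => φ (X ω) * checkFn α (Y ω - a) -
      φ (X ω) * checkFn α (m₁ c + m₂ c * ε ω - a)) P :=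
    Integrable.mono' hbi (hdm.aestronglyMeasurable.sub hgi2.aestronglyMeasurable)
      (ae_of_all _ hpt)
  have hfi : Integrable (fun ω => φ (X ω) * checkFn α (Y ω - a)) P := by
    have := hdi.add hgi2
    refine this.congr (ae_of_all _ fun ω => ?_)
    simp
  have hT : Gtil P Y X proj α a c = (∫ ω, φ (X ω) * checkFn α (Y ω - a) ∂P) / q := by
    unfold Gtil
    rw [funext (hφA (fun ω => checkFn α (Y ω - a)))]
  have hD : ∫ ω, ‖X ω - c‖ ∂(P[|A]) = (∫ ω, φ (X ω) * ‖X ω - c‖ ∂P) / q := by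
    rw [funext (hφA (fun ω => ‖X ω - c‖)), integral_indicator hAm, ProbabilityTheory.cond,
      integral_smul_measure, ENNReal.toReal_inv, smul_eq_mul, div_eq_inv_mul]
  have hmain : |∫ ω, φ (X ω) * checkFn α (Y ω - a) ∂P - q * Gfun P ε m₁ m₂ α a c| ≤
      max α (1 - α) * (K₁ + K₂ * ∫ ω, |ε ω| ∂P) * ∫ ω, φ (X ω) * ‖X ω - c‖ ∂P := by
    rw [← hG, ← integral_sub hfi hgi2]
    refine abs_integral_le_integral_abs.trans ((integral_mono hdi.abs hbi hpt).trans ?_)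
    rw [integral_const_mul, hind2.integral_fun_mul_eq_mul_integral hei.aestronglyMeasurable
      hKi.aestronglyMeasurable, integral_add (integrable_const _)
      (hε.abs.const_mul _), integral_const_mul]
    simp only [integral_const, probReal_univ, one_smul]
    apply le_of_eq; ring
  have : Gtil P Y X proj α a c - Gfun P ε m₁ m₂ α a c =
      (∫ ω, φ (X ω) * checkFn α (Y ω - a) ∂P - q * Gfun P ε m₁ m₂ α a c) / q := by
    rw [hT]; field_simp
  rw [this, abs_div, abs_of_pos hqpos, hD, ← mul_div_assoc]
  gcongr

/-- in the location-scale model `Y = m₁(X) + m₂(X)ε`, for any finite grid `γ`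
with nearest-point projection `proj` all of whose cells have positive mass,
`‖sup_{a∈ℝ} |G̃_a(X̃) − G_a(X)|‖_{L^p} ≤ 2·max(α,1−α)·[m]_Lip·‖X̃ − X‖_{L^p}`, where
`[m]_Lip = K₁ + K₂·(E[|ε|^p])^{1/p}` and `X̃ = proj ∘ X`. -/
theorem Lp_sup_Gtil_sub_Gfun_le {d : ℕ} (hd : 1 ≤ d) (α p : ℝ)
    (hα : α ∈ Set.Ioo (0:ℝ) 1) (hp : 1 ≤ p)
    {Ω : Type*} [MeasurableSpace Ω] (P : Measure Ω) [IsProbabilityMeasure P]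
    (X : Ω → EuclideanSpace ℝ (Fin d)) (ε : Ω → ℝ) (hXm : Measurable X) (hεm : Measurable ε)
    (hindep : IndepFun X ε P)
    (m₁ m₂ : EuclideanSpace ℝ (Fin d) → ℝ) (K₁ K₂ : NNReal)
    (h₁ : LipschitzWith K₁ m₁) (h₂ : LipschitzWith K₂ m₂) (h₂pos : ∀ x, 0 < m₂ x)
    (hXmom : Integrable (fun ω => ‖X ω‖ ^ p) P)
    (hεmom : Integrable (fun ω => |ε ω| ^ p) P)
    (Y : Ω → ℝ) (hY : ∀ ω, Y ω = m₁ (X ω) + m₂ (X ω) * ε ω)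
    (γ : Finset (EuclideanSpace ℝ (Fin d)))
    (proj : EuclideanSpace ℝ (Fin d) → EuclideanSpace ℝ (Fin d))
    (hproj : IsNearestProj γ proj)
    (hmass : ∀ c ∈ γ, 0 < P {ω | proj (X ω) = c}) :
    (∫ ω, (⨆ a : ℝ, |Gtil P Y X proj α a (proj (X ω)) - Gfun P ε m₁ m₂ α a (X ω)|) ^ p ∂P)
        ^ (1 / p) ≤
      2 * max α (1 - α) * ((K₁ : ℝ) + (K₂ : ℝ) * (∫ ω, |ε ω| ^ p ∂P) ^ (1 / p)) *
        (∫ ω, ‖proj (X ω) - X ω‖ ^ p ∂P) ^ (1 / p) := by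
  obtain ⟨hpm, hpr⟩ := hproj
  have hp0 : 0 < p := by linarith
  have hM : 0 ≤ max α (1 - α) := le_max_of_le_left hα.1.le
  have hεai : Integrable (fun ω => |ε ω|) P :=
    aux_int_of_pow P _ p hp (fun _ => abs_nonneg _) (by fun_prop) hεmom
  have hε : Integrable ε P := (integrable_norm_iff hεm.aestronglyMeasurable).1 hεai
  have hXci : ∀ c, Integrable (fun ω => ‖X ω - c‖ ^ p) P := by
    intro c
    refine Integrable.mono' ((hXmom.add (integrable_const (‖c‖ ^ p))).const_mul (2 ^ (p - 1)))
      ((hXm.sub_const c).norm.pow_const p).aestronglyMeasurable (ae_of_all _ fun ω => ?_)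
    rw [Real.norm_of_nonneg (by positivity)]
    refine (Real.rpow_le_rpow (norm_nonneg _) (norm_sub_le _ _) hp0.le).trans ?_
    exact aux_add_pow _ _ p (norm_nonneg _) (norm_nonneg _) hp
  have hXc1 : ∀ c, Integrable (fun ω => ‖X ω - c‖) P := fun c =>
    aux_int_of_pow P _ p hp (fun _ => norm_nonneg _) (by fun_prop) (hXci c)
  let A : EuclideanSpace ℝ (Fin d) → Set Ω := fun c => {ω | proj (X ω) = c}
  have hAm : ∀ c, MeasurableSet (A c) := fun c => (hpm.comp hXm) (measurableSet_singleton c)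
  let D : EuclideanSpace ℝ (Fin d) → ℝ := fun c => ∫ ω, ‖X ω - c‖ ∂(P[|A c])
  have hD0 : ∀ c, 0 ≤ D c := fun c => integral_nonneg fun _ => norm_nonneg _
  -- decomposition over the cells
  have hsum : ∀ (F : EuclideanSpace ℝ (Fin d) → Ω → ℝ) ω,
      F (proj (X ω)) ω = ∑ c ∈ γ, (A c).indicator (F c) ω := by
    intro F ω
    rw [Finset.sum_eq_single (proj (X ω))]
    · simp [A]
    · intro b _ hb
      have hn : ω ∉ A b := fun h => hb (Eq.symm h)
      exact Set.indicator_of_notMem hn _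
    · intro h; exact absurd (hpr (X ω)).1 h
  have hcell : ∀ (F : EuclideanSpace ℝ (Fin d) → Ω → ℝ), (∀ c, Integrable (F c) P) →
      Integrable (fun ω => F (proj (X ω)) ω) P ∧
      ∫ ω, F (proj (X ω)) ω ∂P = ∑ c ∈ γ, ∫ ω in A c, F c ω ∂P := by
    intro F hF
    rw [funext (hsum F)]
    refine ⟨integrable_finsetSum _ fun c _ => (hF c).indicator (hAm c), ?_⟩
    rw [integral_finsetSum _ fun c _ => (hF c).indicator (hAm c)]
    exact Finset.sum_congr rfl fun c _ => integral_indicator (hAm c)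
  obtain ⟨hei, hesum⟩ := hcell (fun c ω => ‖X ω - c‖ ^ p) hXci
  obtain ⟨hDi, hDsum⟩ := hcell (fun c _ => D c ^ p) (fun c => integrable_const _)
  have hJ : ∫ ω, D (proj (X ω)) ^ p ∂P ≤ ∫ ω, ‖X ω - proj (X ω)‖ ^ p ∂P := by
    rw [hesum, hDsum]
    refine Finset.sum_le_sum fun c hc => ?_
    have hpos : 0 < (P (A c)).toReal := ENNReal.toReal_pos (hmass c hc).ne' (measure_ne_top _ _)
    haveI : IsProbabilityMeasure (P[|A c]) := cond_isProbabilityMeasure (hmass c hc).ne'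
    have hci : ∀ f : Ω → ℝ, Integrable f P → Integrable f (P[|A c]) := fun f hf =>
      (hf.restrict (s := A c)).smul_measure (ENNReal.inv_ne_top.2 (hmass c hc).ne')
    have hj := aux_jensen (P[|A c]) (fun ω => ‖X ω - c‖) p hp (fun _ => norm_nonneg _)
      (hci _ (hXc1 c)) (hci _ (hXci c))
    have hE : ∫ ω, ‖X ω - c‖ ^ p ∂(P[|A c]) =
        (P (A c)).toReal⁻¹ * ∫ ω in A c, ‖X ω - c‖ ^ p ∂P := by
      rw [ProbabilityTheory.cond, integral_smul_measure, ENNReal.toReal_inv, smul_eq_mul]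
    rw [hE] at hj
    have : ∫ ω in A c, D c ^ p ∂P = (P (A c)).toReal * D c ^ p := by
      simp [Measure.real]
    rw [this]
    calc _ ≤ (P (A c)).toReal * ((P (A c)).toReal⁻¹ * ∫ ω in A c, ‖X ω - c‖ ^ p ∂P) :=
          mul_le_mul_of_nonneg_left hj hpos.le
      _ = _ := by field_simp
  set Le : ℝ := ∫ ω, |ε ω| ∂P with hLe
  have hLe0 : 0 ≤ Le := integral_nonneg fun _ => abs_nonneg _
  set L : ℝ := max α (1 - α) * (K₁ + K₂ * Le) with hL
  have hL0 : 0 ≤ L := by positivity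
  have hsup : ∀ ω, (⨆ a : ℝ, |Gtil P Y X proj α a (proj (X ω)) - Gfun P ε m₁ m₂ α a (X ω)|) ≤
      L * (D (proj (X ω)) + ‖X ω - proj (X ω)‖) := by
    intro ω
    refine ciSup_le fun a => ?_
    have b1 := aux_cell α hα P X ε hXm hεm hindep hε m₁ m₂ K₁ K₂ h₁ h₂ Y hY proj hpm
      (proj (X ω)) (hmass _ (hpr _).1) (hXc1 _) a
    have b2 := (aux_Gfun_lip α hα P ε hεm hε m₁ m₂ K₁ K₂ h₁ h₂ a (proj (X ω)) (X ω)).2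
    rw [norm_sub_rev] at b2
    rw [mul_add]
    exact (abs_sub_le _ _ _).trans (add_le_add b1 b2)
  have hsup0 : ∀ ω, 0 ≤ (⨆ a : ℝ, |Gtil P Y X proj α a (proj (X ω)) -
      Gfun P ε m₁ m₂ α a (X ω)|) := fun ω => Real.iSup_nonneg fun _ => abs_nonneg _
  set I : ℝ := ∫ ω, ‖proj (X ω) - X ω‖ ^ p ∂P with hI
  have hI' : ∫ ω, ‖X ω - proj (X ω)‖ ^ p ∂P = I := by
    simp only [hI, norm_sub_rev]
  have hI0 : 0 ≤ I := integral_nonneg fun _ => by positivity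
  have key : (∫ ω, (⨆ a : ℝ, |Gtil P Y X proj α a (proj (X ω)) -
      Gfun P ε m₁ m₂ α a (X ω)|) ^ p ∂P) ≤ L ^ p * (2 ^ p * I) := by
    have hgi : Integrable (fun ω => L ^ p * (2 ^ (p - 1) *
        (D (proj (X ω)) ^ p + ‖X ω - proj (X ω)‖ ^ p))) P :=
      ((hDi.add hei).const_mul _).const_mul _
    refine (integral_mono_of_nonneg (ae_of_all _ fun ω => Real.rpow_nonneg (hsup0 ω) p) hgi
      (ae_of_all _ fun ω => ?_)).trans ?_
    · refine (Real.rpow_le_rpow (hsup0 ω) (hsup ω) hp0.le).trans ?_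
      rw [Real.mul_rpow hL0 (add_nonneg (hD0 _) (norm_nonneg _))]
      exact mul_le_mul_of_nonneg_left (aux_add_pow _ _ p (hD0 _) (norm_nonneg _) hp)
        (by positivity)
    · rw [integral_const_mul, integral_const_mul, integral_add hDi hei]
      refine mul_le_mul_of_nonneg_left ?_ (by positivity)
      have h2 : (2:ℝ) ^ p = 2 ^ (p - 1) * 2 := by
        rw [← Real.rpow_add_one (by norm_num)]; congr 1; ring
      rw [h2, mul_assoc]
      refine mul_le_mul_of_nonneg_left ?_ (by positivity)
      linarith
  have hLe' : Le ≤ (∫ ω, |ε ω| ^ p ∂P) ^ (1 / p) := by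
    have := aux_jensen P (fun ω => |ε ω|) p hp (fun _ => abs_nonneg _) hεai hεmom
    have h3 := Real.rpow_le_rpow (by positivity) this (by positivity : 0 ≤ 1 / p)
    rwa [← Real.rpow_mul hLe0, mul_one_div_cancel hp0.ne', Real.rpow_one] at h3
  have hroot : (L ^ p * (2 ^ p * I)) ^ (1 / p) = L * (2 * I ^ (1 / p)) := by
    rw [Real.mul_rpow (by positivity) (by positivity), Real.mul_rpow (by positivity) hI0,
      ← Real.rpow_mul hL0, ← Real.rpow_mul (by norm_num), mul_one_div_cancel hp0.ne',
      Real.rpow_one, Real.rpow_one]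
  refine (Real.rpow_le_rpow (integral_nonneg fun ω => Real.rpow_nonneg (hsup0 ω) p) key
    (by positivity)).trans ?_
  rw [hroot, hL]
  calc _ = 2 * max α (1 - α) * (K₁ + K₂ * Le) * I ^ (1 / p) := by ring
    _ ≤ _ := by gcongr
end

section
/- Fix α ∈ (0,1), N ∈ ℕ, and x ∈ ℝ^d. Assume Y = m₁(X) + m₂(X)ε where X is an ℝ^d-valued random vector independent of the real random variable ε, m₁ : ℝ^d → ℝ and m₂ : ℝ^d → (0,∞) are Lipschitz, E[|X|²] < ∞, E[|ε|²] < ∞, and the law of X is absolutely continuous with compact support. Let γ^N = {x̃₁,…,x̃_N} be an L₂-optimal N-grid for X with positive-mass cells, assume the nearest point of γ^N to x is unique, and let q̃ = q̃^N_α(x) be the unique minimizer of a ↦ G̃_a(x̃) = E[ρ_α(Y−a)·1_{X∈C_x}]/P(X∈C_x), where x̃ = Proj_{γ^N}(x) and C_x is the cell of x. Let (X₁,Y₁), (X₂,Y₂), … be i.i.d. copies of (X,Y), and for each n let γ̂^n = (x̂₁^n,…,x̂_N^n) be a random N-point grid, measurable with respect to X₁,…,X_n, such that x̂_i^n → x̃_i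 almost surely for each i = 1,…,N. For each n let q̂_n be any minimizer over a ∈ ℝ of a ↦ Σ_{i=1}^n ρ_α(Y_i − a)·1_{Proj_{γ̂^n}(X_i) = Proj_{γ̂^n}(x)}. Then |q̂_n − q̃| → 0 in probability as n → ∞. -/
open MeasureTheory ProbabilityTheory Filter

attribute [local instance] Classical.propDecidable

lemma checkFn_eq_max (α z : ℝ) : checkFn α z = max (α * z) ((α - 1) * z) := by
  unfold checkFn
  split_ifs with h
  · rw [max_eq_right (by nlinarith)]; ring
  · rw [max_eq_left (by nlinarith)]; ring

lemma checkFn_nonneg {α : ℝ} (hα : α ∈ Set.Ioo (0:ℝ) 1) (z : ℝ) : 0 ≤ checkFn α z := by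
  rw [checkFn_eq_max]
  obtain ⟨h0, h1⟩ := hα
  rcases le_total 0 z with h | h
  · exact le_max_of_le_left (by nlinarith)
  · exact le_max_of_le_right (by nlinarith)

lemma checkFn_le {α : ℝ} (hα : α ∈ Set.Ioo (0:ℝ) 1) (z : ℝ) : checkFn α z ≤ |z| := by
  rw [checkFn_eq_max]
  obtain ⟨h0, h1⟩ := hα
  have := abs_nonneg z
  have := le_abs_self z
  have := neg_abs_le z
  apply max_le <;> nlinarith

lemma checkFn_cont (α : ℝ) : Continuous (checkFn α) := by
  have : checkFn α = fun z => max (α * z) ((α - 1) * z) := funext (checkFn_eq_max α)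
  rw [this]; fun_prop

lemma checkFn_convex (α y p q t : ℝ) (h0 : 0 ≤ t) (h1 : t ≤ 1) :
    checkFn α (y - ((1 - t) * p + t * q)) ≤
      (1 - t) * checkFn α (y - p) + t * checkFn α (y - q) := by
  simp only [checkFn_eq_max]
  have a1 := le_max_left (α * (y - p)) ((α - 1) * (y - p))
  have a2 := le_max_right (α * (y - p)) ((α - 1) * (y - p))
  have b1 := le_max_left (α * (y - q)) ((α - 1) * (y - q))
  have b2 := le_max_right (α * (y - q)) ((α - 1) * (y - q))
  have h2 : 0 ≤ 1 - t := by linarith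
  apply max_le
  · have := mul_le_mul_of_nonneg_left a1 h2
    have := mul_le_mul_of_nonneg_left b1 h0
    nlinarith
  · have := mul_le_mul_of_nonneg_left a2 h2
    have := mul_le_mul_of_nonneg_left b2 h0
    nlinarith

lemma wsum_convex {α : ℝ} (n : ℕ) (w y : ℕ → ℝ) (hw : ∀ i, 0 ≤ w i) (p b q : ℝ)
    (hpb : p ≠ b) (hbt : ∃ t, 0 ≤ t ∧ t ≤ 1 ∧ b = (1 - t) * p + t * q)
    (hmin : ∑ i ∈ Finset.range n, w i * checkFn α (y i - q) ≤
      ∑ i ∈ Finset.range n, w i * checkFn α (y i - p)) :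
    ∑ i ∈ Finset.range n, w i * checkFn α (y i - b) ≤
      ∑ i ∈ Finset.range n, w i * checkFn α (y i - p) := by
  obtain ⟨t, h0, h1, rfl⟩ := hbt
  calc _ ≤ ∑ i ∈ Finset.range n, ((1 - t) * (w i * checkFn α (y i - p)) +
        t * (w i * checkFn α (y i - q))) := by
        apply Finset.sum_le_sum
        intro i _
        have := mul_le_mul_of_nonneg_left (checkFn_convex α (y i) p q t h0 h1) (hw i)
        linarith
    _ = (1 - t) * ∑ i ∈ Finset.range n, (w i * checkFn α (y i - p)) +
        t * ∑ i ∈ Finset.range n, (w i * checkFn α (y i - q)) := by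
        rw [Finset.sum_add_distrib, Finset.mul_sum, Finset.mul_sum]
    _ ≤ _ := by nlinarith

lemma bisector_null {d : ℕ} (μ : Measure (EuclideanSpace ℝ (Fin d)))
    (habs : μ.AbsolutelyContinuous volume) (p q : EuclideanSpace ℝ (Fin d)) (hpq : p ≠ q) :
    μ {z | dist z p = dist z q} = 0 := by
  apply habs
  have h : {z | dist z p = dist z q} = (AffineSubspace.perpBisector p q : Set _) := by
    ext z; simp [AffineSubspace.mem_perpBisector_iff_dist_eq]
  rw [h]
  apply Measure.addHaar_affineSubspace
  intro ht
  have : p ∈ AffineSubspace.perpBisector p q := by rw [ht]; trivial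
  rw [AffineSubspace.mem_perpBisector_iff_dist_eq, dist_self] at this
  exact hpq (dist_eq_zero.1 this.symm)

lemma infDist_sq_integrable {d : ℕ} (μ : Measure (EuclideanSpace ℝ (Fin d)))
    [IsProbabilityMeasure μ] (hmom : Integrable (fun z => ‖z‖ ^ (2:ℝ)) μ)
    (γ : Finset (EuclideanSpace ℝ (Fin d))) (hγ : γ.Nonempty) :
    Integrable (fun z => Metric.infDist z (γ : Set (EuclideanSpace ℝ (Fin d))) ^ (2:ℝ)) μ := by
  obtain ⟨p, hp⟩ := hγ
  simp only [Real.rpow_two] at hmom ⊢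
  refine Integrable.mono' (g := fun z => 2 * ‖z‖ ^ 2 + 2 * ‖p‖ ^ 2)
    ((hmom.const_mul 2).add (integrable_const _)) ?_ ?_
  · exact ((Metric.continuous_infDist_pt _).pow 2).aestronglyMeasurable
  · refine Eventually.of_forall fun z => ?_
    have h1 : Metric.infDist z (γ : Set (EuclideanSpace ℝ (Fin d))) ≤ ‖z‖ + ‖p‖ :=
      (Metric.infDist_le_dist_of_mem (by exact_mod_cast hp)).trans (by
        rw [dist_eq_norm]; exact norm_sub_le _ _)
    have h0 := Metric.infDist_nonneg (x := z) (s := (γ : Set (EuclideanSpace ℝ (Fin d))))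
    rw [Real.norm_of_nonneg (by positivity)]
    nlinarith [sq_nonneg (‖z‖ - ‖p‖)]

lemma grid_inj {d : ℕ} (hd : 1 ≤ d) (N : ℕ) (μ : Measure (EuclideanSpace ℝ (Fin d)))
    [IsProbabilityMeasure μ] (hmom : Integrable (fun z => ‖z‖ ^ (2:ℝ)) μ)
    (habs : μ.AbsolutelyContinuous volume)
    (xt : Fin N → EuclideanSpace ℝ (Fin d))
    (hgrid : IsOptimalGrid μ 2 N (Finset.image xt Finset.univ)) : Function.Injective xt := by
  by_contra hinj
  have : Nonempty (Fin d) := ⟨⟨0, hd⟩⟩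
  obtain ⟨hne, -, hopt⟩ := hgrid
  set γ := Finset.image xt Finset.univ with hγ
  have hcard : γ.card < N := by
    have h1 : γ.card ≤ N := by simpa using Finset.card_image_le (s := Finset.univ) (f := xt)
    refine lt_of_le_of_ne h1 fun h => hinj ?_
    have := (Finset.card_image_iff (s := Finset.univ) (f := xt)).1 (by rw [← hγ, h]; simp)
    simpa [Set.injOn_univ] using this
  have h0 : μ (γ : Set (EuclideanSpace ℝ (Fin d))) = 0 :=
    habs (γ.finite_toSet.measure_zero _)
  have hc : μ ((γ : Set (EuclideanSpace ℝ (Fin d)))ᶜ) ≠ 0 := by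
    rw [prob_compl_eq_one_sub γ.finite_toSet.measurableSet, h0]; simp
  obtain ⟨z₀, hz₀, hpos⟩ := exists_mem_forall_mem_nhdsWithin_pos_measure hc
  have hle := hopt (insert z₀ γ) (Finset.insert_nonempty _ _)
    ((Finset.card_insert_le _ _).trans hcard)
  have hi1 := infDist_sq_integrable μ hmom γ hne
  have hi2 := infDist_sq_integrable μ hmom (insert z₀ γ) (Finset.insert_nonempty _ _)
  unfold qErr at hle
  have hmono : ∀ z, Metric.infDist z ((insert z₀ γ : Finset _) : Set (EuclideanSpace ℝ (Fin d)))
      ≤ Metric.infDist z (γ : Set (EuclideanSpace ℝ (Fin d))) := fun z =>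
    Metric.infDist_le_infDist_of_subset (by simp) (by exact_mod_cast hne)
  have hpos2 : 0 < ∫ z, (Metric.infDist z (γ : Set (EuclideanSpace ℝ (Fin d))) ^ (2:ℝ) -
      Metric.infDist z ((insert z₀ γ : Finset _) : Set (EuclideanSpace ℝ (Fin d))) ^ (2:ℝ)) ∂μ := by
    refine (integral_pos_iff_support_of_nonneg ?_ (hi1.sub hi2)).2 ?_
    rotate_left
    · have hr : 0 < Metric.infDist z₀ (γ : Set (EuclideanSpace ℝ (Fin d))) :=
        (γ.finite_toSet.isClosed.notMem_iff_infDist_pos (by exact_mod_cast hne)).1 hz₀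
      set r := Metric.infDist z₀ (γ : Set (EuclideanSpace ℝ (Fin d)))
      refine lt_of_lt_of_le (hpos (Metric.ball z₀ (r / 2))
        (mem_nhdsWithin_of_mem_nhds (Metric.ball_mem_nhds _ (by positivity)))) (measure_mono ?_)
      intro z hz
      rw [Metric.mem_ball] at hz
      have h1 : Metric.infDist z ((insert z₀ γ : Finset _) : Set (EuclideanSpace ℝ (Fin d)))
        ≤ dist z z₀ := Metric.infDist_le_dist_of_mem (by simp)
      have h2 : r ≤ Metric.infDist z (γ : Set (EuclideanSpace ℝ (Fin d))) + dist z₀ z :=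
        Metric.infDist_le_infDist_add_dist
      rw [dist_comm] at h2
      have h3 := Metric.infDist_nonneg (x := z)
        (s := ((insert z₀ γ : Finset _) : Set (EuclideanSpace ℝ (Fin d))))
      rw [Function.mem_support]
      show Metric.infDist z (γ : Set (EuclideanSpace ℝ (Fin d))) ^ (2:ℝ) - Metric.infDist z
        ((insert z₀ γ : Finset _) : Set (EuclideanSpace ℝ (Fin d))) ^ (2:ℝ) ≠ 0
      simp only [Real.rpow_two]
      have : 0 < Metric.infDist z (γ : Set (EuclideanSpace ℝ (Fin d))) - 
        Metric.infDist z ((insert z₀ γ : Finset _) : Set (EuclideanSpace ℝ (Fin d))) := by linarith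
      nlinarith
    · intro z
      have h3 := Metric.infDist_nonneg (x := z)
        (s := ((insert z₀ γ : Finset _) : Set (EuclideanSpace ℝ (Fin d))))
      simp only [Real.rpow_two, Pi.zero_apply, Pi.sub_apply, sub_nonneg]
      exact pow_le_pow_left₀ h3 (hmono z) 2
  rw [integral_sub hi1 hi2] at hpos2
  linarith

/-- boundary layer around the cell of index `k`. -/
def blayer {d N : ℕ} (xt : Fin N → EuclideanSpace ℝ (Fin d)) (k : Fin N) (δ : ℝ) :
    Set (EuclideanSpace ℝ (Fin d)) :=
  {z | ∃ j, j ≠ k ∧ |dist z (xt j) - dist z (xt k)| ≤ δ}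

lemma blayer_meas {d N : ℕ} (xt : Fin N → EuclideanSpace ℝ (Fin d)) (k : Fin N) (δ : ℝ) :
    MeasurableSet (blayer xt k δ) := by
  have : blayer xt k δ = ⋃ j, ⋃ (_ : j ≠ k), {z | |dist z (xt j) - dist z (xt k)| ≤ δ} := by
    ext z; simp [blayer]
  rw [this]
  refine MeasurableSet.iUnion fun j => MeasurableSet.iUnion fun _ => ?_
  exact (isClosed_le (by fun_prop) continuous_const).measurableSet

lemma cell_stable {d N : ℕ} (xt xh : Fin N → EuclideanSpace ℝ (Fin d)) (k : Fin N) (δ : ℝ)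
    (proj projh : EuclideanSpace ℝ (Fin d) → EuclideanSpace ℝ (Fin d))
    (hproj : ∀ z, ∃ i, proj z = xt i ∧ ∀ j, dist z (xt i) ≤ dist z (xt j))
    (hprojh : ∀ z, ∃ i, projh z = xh i ∧ ∀ j, dist z (xh i) ≤ dist z (xh j))
    (hclose : ∀ i, dist (xh i) (xt i) < δ / 4)
    (x z : EuclideanSpace ℝ (Fin d))
    (hx : ∀ j, j ≠ k → dist x (xt k) + δ < dist x (xt j))
    (hz : z ∉ blayer xt k δ) :
    projh z = projh x ↔ proj z = xt k := by
  have up : ∀ w i, dist w (xh i) < dist w (xt i) + δ / 4 := fun w i => by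
    have := dist_triangle w (xt i) (xh i)
    have := hclose i
    rw [dist_comm] at this
    linarith
  have lo : ∀ w i, dist w (xt i) < dist w (xh i) + δ / 4 := fun w i => by
    have := dist_triangle w (xh i) (xt i)
    have := hclose i
    linarith
  have hδ : 0 < δ := by have := hclose k; have := dist_nonneg (x := xh k) (y := xt k); linarith
  have key : ∀ w, (∀ j, j ≠ k → dist w (xt k) + δ < dist w (xt j)) → projh w = xh k := by
    intro w hw
    obtain ⟨i, hi, hm⟩ := hprojh w
    by_cases hik : i = k
    · rw [hi, hik]
    · have := hw i hik
      have := hm k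
      have := up w k
      have := lo w i
      linarith
  rw [key x hx]
  by_cases hA : ∀ j, j ≠ k → dist z (xt k) + δ < dist z (xt j)
  · refine iff_of_true (key z hA) ?_
    obtain ⟨i, hi, hm⟩ := hproj z
    by_cases hik : i = k
    · rw [hi, hik]
    · have := hA i hik
      have := hm k
      linarith
  · push Not at hA
    obtain ⟨j, hjk, hj⟩ := hA
    have hj2 : dist z (xt j) + δ < dist z (xt k) := by
      by_contra hcon
      exact hz ⟨j, hjk, abs_le.2 ⟨by linarith, by linarith⟩⟩
    refine iff_of_false ?_ ?_
    · intro h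
      obtain ⟨i, hi, hm⟩ := hprojh z
      have h1 := hm j
      rw [← hi, h] at h1
      have := up z j
      have := lo z k
      linarith
    · intro h
      obtain ⟨i, hi, hm⟩ := hproj z
      have h1 := hm j
      rw [← hi, h] at h1
      linarith

/-- the comparison function. -/
noncomputable def gcomp {d : ℕ} (α : ℝ) (A B : Set (EuclideanSpace ℝ (Fin d))) (q b : ℝ)
    (p : EuclideanSpace ℝ (Fin d) × ℝ) : ℝ :=
  A.indicator (fun _ => checkFn α (p.2 - b) - checkFn α (p.2 - q)) p.1 -
    B.indicator (fun _ => checkFn α (p.2 - b) + checkFn α (p.2 - q)) p.1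

lemma gcomp_meas {d : ℕ} (α : ℝ) {A B : Set (EuclideanSpace ℝ (Fin d))} (hA : MeasurableSet A)
    (hB : MeasurableSet B) (q b : ℝ) : Measurable (gcomp α A B q b) := by
  have hc := (checkFn_cont α).measurable
  have e : gcomp α A B q b = fun p : EuclideanSpace ℝ (Fin d) × ℝ =>
     (Prod.fst ⁻¹' A).indicator (fun p => checkFn α (p.2 - b) - checkFn α (p.2 - q)) p -
     (Prod.fst ⁻¹' B).indicator (fun p => checkFn α (p.2 - b) + checkFn α (p.2 - q)) p := by
    funext p; simp [gcomp, Set.indicator]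
  rw [e]
  refine Measurable.sub ?_ ?_
  · refine Measurable.indicator ?_ (measurable_fst hA)
    exact (hc.comp (by fun_prop)).sub (hc.comp (by fun_prop))
  · refine Measurable.indicator ?_ (measurable_fst hB)
    exact (hc.comp (by fun_prop)).add (hc.comp (by fun_prop))

lemma gcomp_le {d : ℕ} {α : ℝ} (hα : α ∈ Set.Ioo (0:ℝ) 1)
    (A B C : Set (EuclideanSpace ℝ (Fin d))) (q b : ℝ)
    (z : EuclideanSpace ℝ (Fin d)) (y : ℝ) (h : z ∉ B → (z ∈ C ↔ z ∈ A)) :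
    gcomp α A B q b (z, y) ≤
      C.indicator (fun _ => (1:ℝ)) z * checkFn α (y - b) -
      C.indicator (fun _ => (1:ℝ)) z * checkFn α (y - q) := by
  have h1 := checkFn_nonneg hα (y - b)
  have h2 := checkFn_nonneg hα (y - q)
  unfold gcomp
  by_cases hB : z ∈ B
  · by_cases hC : z ∈ C <;> by_cases hA : z ∈ A <;> simp [hA, hB, hC] <;> linarith
  · have := h hB
    by_cases hA : z ∈ A
    · simp [hA, hB, this.2 hA]
    · have hC : z ∉ C := fun hh => hA (this.1 hh)
      simp [hA, hB, hC]

lemma min_close {d : ℕ} {α : ℝ} (hα : α ∈ Set.Ioo (0:ℝ) 1)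
    (A B C : Set (EuclideanSpace ℝ (Fin d))) (q e qh : ℝ) (he : 0 < e) (n : ℕ)
    (xs : ℕ → EuclideanSpace ℝ (Fin d)) (ys : ℕ → ℝ)
    (h : ∀ z, z ∉ B → (z ∈ C ↔ z ∈ A))
    (hmin : ∀ a, ∑ i ∈ Finset.range n, C.indicator (fun _ => checkFn α (ys i - qh)) (xs i) ≤
      ∑ i ∈ Finset.range n, C.indicator (fun _ => checkFn α (ys i - a)) (xs i))
    (hp : 0 < ∑ i ∈ Finset.range n, gcomp α A B q (q + e) (xs i, ys i))
    (hm : 0 < ∑ i ∈ Finset.range n, gcomp α A B q (q - e) (xs i, ys i)) :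
    dist qh q < e := by
  have e1 : ∀ a, ∑ i ∈ Finset.range n, C.indicator (fun _ => checkFn α (ys i - a)) (xs i) =
      ∑ i ∈ Finset.range n, C.indicator (fun _ => (1:ℝ)) (xs i) * checkFn α (ys i - a) := by
    intro a
    refine Finset.sum_congr rfl fun i _ => ?_
    by_cases hC : xs i ∈ C <;> simp [hC]
  have hmin' := hmin q
  rw [e1, e1] at hmin'
  have hw : ∀ i, 0 ≤ C.indicator (fun _ => (1:ℝ)) (xs i) := fun i =>
    Set.indicator_nonneg (fun _ _ => zero_le_one) _
  have main : ∀ b, q ≠ b → 0 < ∑ i ∈ Finset.range n, gcomp α A B q b (xs i, ys i) →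
      ¬ ∃ t, 0 ≤ t ∧ t ≤ 1 ∧ b = (1 - t) * q + t * qh := by
    intro b hb hpos ht
    have h1 := wsum_convex n _ ys hw q b qh hb ht hmin'
    have h2 := Finset.sum_le_sum (s := Finset.range n)
      (fun i _ => gcomp_le hα A B C q b (xs i) (ys i) (h (xs i)))
    rw [Finset.sum_sub_distrib] at h2
    linarith
  rw [Real.dist_eq]
  by_contra hcon
  push Not at hcon
  rcases le_abs.1 hcon with hc | hc
  · refine main _ (by intro h; linarith) hp ⟨e / (qh - q), div_nonneg he.le (by linarith), ?_, ?_⟩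
    · rw [div_le_one (by linarith)]; exact hc
    · have : qh - q ≠ 0 := by intro h; linarith
      field_simp; ring
  · refine main _ (by intro h; linarith) hm ⟨e / (q - qh), ?_, ?_, ?_⟩
    · apply div_nonneg <;> linarith
    · rw [div_le_one (by linarith)]; linarith
    · have : q - qh ≠ 0 := by intro h; linarith
      field_simp; ring

lemma slln_pos {d : ℕ} {Ω : Type*} [MeasurableSpace Ω] (P : Measure Ω) [IsProbabilityMeasure P]
    (X : Ω → EuclideanSpace ℝ (Fin d)) (Y : Ω → ℝ) (hXm : Measurable X) (hYm : Measurable Y)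
    (Xs : ℕ → Ω → EuclideanSpace ℝ (Fin d)) (Ys : ℕ → Ω → ℝ)
    (hXsm : ∀ i, Measurable (Xs i)) (hYsm : ∀ i, Measurable (Ys i))
    (hiid : iIndepFun (fun i ω => (Xs i ω, Ys i ω)) P)
    (hident : ∀ i : ℕ,
      P.map (fun ω => (Xs i ω, Ys i ω)) = P.map (fun ω => (X ω, Y ω)))
    (g : EuclideanSpace ℝ (Fin d) × ℝ → ℝ) (hg : Measurable g)
    (hint : Integrable (fun ω => g (X ω, Y ω)) P) (hpos : 0 < ∫ ω, g (X ω, Y ω) ∂P) :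
    ∀ᵐ ω ∂P, ∀ᶠ n in atTop, 0 < ∑ i ∈ Finset.range n, g (Xs i ω, Ys i ω) := by
  have hid : ∀ i, IdentDistrib (fun ω => (Xs i ω, Ys i ω)) (fun ω => (X ω, Y ω)) P P := fun i =>
    ⟨((hXsm i).prodMk (hYsm i)).aemeasurable, (hXm.prodMk hYm).aemeasurable, hident i⟩
  have hid2 : ∀ i, IdentDistrib (fun ω => g (Xs i ω, Ys i ω)) (fun ω => g (X ω, Y ω)) P P :=
    fun i => (hid i).comp hg
  have := strong_law_ae_real (μ := P) (fun i ω => g (Xs i ω, Ys i ω))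
    ((hid2 0).integrable_iff.2 hint)
    (fun i j hij => (hiid.indepFun hij).comp hg hg)
    (fun i => (hid2 i).trans (hid2 0).symm)
  rw [(hid2 0).integral_eq] at this
  filter_upwards [this] with ω hω
  filter_upwards [hω.eventually (lt_mem_nhds hpos)] with n hn
  by_contra hcon
  exact absurd hn (not_lt.2 (div_nonpos_of_nonpos_of_nonneg (not_lt.1 hcon) (Nat.cast_nonneg n)))

lemma gcomp_pos {d N : ℕ} {Ω : Type*} [MeasurableSpace Ω] (P : Measure Ω) [IsProbabilityMeasure P]
    {α : ℝ} (hα : α ∈ Set.Ioo (0:ℝ) 1)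
    (X : Ω → EuclideanSpace ℝ (Fin d)) (Y : Ω → ℝ) (hXm : Measurable X)
    (hYi : Integrable Y P) (habs : (P.map X).AbsolutelyContinuous volume)
    (xt : Fin N → EuclideanSpace ℝ (Fin d)) (hinj : Function.Injective xt) (k : Fin N)
    (proj : EuclideanSpace ℝ (Fin d) → EuclideanSpace ℝ (Fin d)) (hproj : Measurable proj)
    (hmass : 0 < P {ω | proj (X ω) = xt k})
    (qt b : ℝ) (hb : Gtil P Y X proj α qt (xt k) < Gtil P Y X proj α b (xt k)) :
    (∀ m : ℕ, Integrable (fun ω => gcomp α {z | proj z = xt k}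
      (blayer xt k (1 / ((m : ℝ) + 1))) qt b (X ω, Y ω)) P) ∧
    ∀ᶠ m : ℕ in atTop, 0 < ∫ ω, gcomp α {z | proj z = xt k}
      (blayer xt k (1 / ((m : ℝ) + 1))) qt b (X ω, Y ω) ∂P := by
  have hρ : ∀ a, Integrable (fun ω => checkFn α (Y ω - a)) P := fun a => by
    refine Integrable.mono' (hYi.sub (integrable_const a)).abs
      ((checkFn_cont α).comp_aestronglyMeasurable
        (hYi.aestronglyMeasurable.sub aestronglyMeasurable_const)) ?_
    refine Eventually.of_forall fun ω => ?_
    rw [Real.norm_of_nonneg (checkFn_nonneg hα _)]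
    exact checkFn_le hα _
  set A : Set (EuclideanSpace ℝ (Fin d)) := {z | proj z = xt k} with hAdef
  have hA : MeasurableSet (X ⁻¹' A) := hXm (hproj (measurableSet_singleton _))
  set s : ℕ → Set Ω := fun m => X ⁻¹' (blayer xt k (1 / ((m : ℝ) + 1))) with hs
  have hsm : ∀ m, MeasurableSet (s m) := fun m => hXm (blayer_meas _ _ _)
  have eq : ∀ m : ℕ, (fun ω => gcomp α A (blayer xt k (1 / ((m : ℝ) + 1))) qt b (X ω, Y ω)) =
      fun ω => ((X ⁻¹' A).indicator (fun ω => checkFn α (Y ω - b)) ω -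
        (X ⁻¹' A).indicator (fun ω => checkFn α (Y ω - qt)) ω) -
        (s m).indicator (fun ω => checkFn α (Y ω - b) + checkFn α (Y ω - qt)) ω := by
    intro m; funext ω
    unfold gcomp
    by_cases h1 : X ω ∈ A <;> by_cases h2 : X ω ∈ blayer xt k (1 / ((m : ℝ) + 1)) <;>
      simp [h1, h2, hs, Set.indicator]
  have i1 := (hρ b).indicator hA
  have i2 := (hρ qt).indicator hA
  have i3 := fun m => ((hρ b).add (hρ qt)).indicator (hsm m)
  refine ⟨fun m => by rw [eq m]; exact (i1.sub i2).sub (i3 m), ?_⟩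
  have hF : 0 < (∫ ω, (X ⁻¹' A).indicator (fun ω => checkFn α (Y ω - b)) ω ∂P) -
      ∫ ω, (X ⁻¹' A).indicator (fun ω => checkFn α (Y ω - qt)) ω ∂P := by
    have hp : 0 < (P {ω | proj (X ω) = xt k}).toReal :=
      ENNReal.toReal_pos hmass.ne' (measure_ne_top _ _)
    unfold Gtil at hb
    rw [div_lt_div_iff_of_pos_right hp] at hb
    exact sub_pos.2 hb
  have hanti : Antitone s := by
    intro m m' hmm ω hω
    obtain ⟨j, hj, hle⟩ := hω
    refine ⟨j, hj, hle.trans ?_⟩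
    exact one_div_le_one_div_of_le (by positivity) (by gcongr)
  have hlim := tendsto_setIntegral_of_antitone (μ := P)
    (f := fun ω => checkFn α (Y ω - b) + checkFn α (Y ω - qt)) hsm hanti
    ⟨0, ((hρ b).add (hρ qt)).integrableOn⟩
  have hnull : P (⋂ n, s n) = 0 := by
    have hsub : (⋂ n, s n) ⊆ X ⁻¹' ⋃ j, ⋃ (_ : j ≠ k), {z | dist z (xt j) = dist z (xt k)} := by
      intro ω hω
      by_contra hcon
      simp only [Set.mem_preimage, Set.mem_iUnion, Set.mem_ofPred_eq, exists_prop, not_exists,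
        not_and] at hcon
      have : ∀ᶠ m : ℕ in atTop, ∀ j, j ≠ k →
          1 / ((m : ℝ) + 1) < |dist (X ω) (xt j) - dist (X ω) (xt k)| := by
        refine eventually_all.2 fun j => ?_
        by_cases hj : j = k
        · exact Eventually.of_forall fun m h => absurd hj h
        · have h0 : 0 < |dist (X ω) (xt j) - dist (X ω) (xt k)| :=
            abs_pos.2 (sub_ne_zero.2 (hcon j hj))
          filter_upwards [(tendsto_one_div_add_atTop_nhds_zero_nat (𝕜 := ℝ)).eventually
            (gt_mem_nhds h0)] with m hm _ using hm
      obtain ⟨m, hm⟩ := this.exists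
      obtain ⟨j, hj, hle⟩ := Set.mem_iInter.1 hω m
      exact absurd hle (not_le.2 (hm j hj))
    refine measure_mono_null hsub ?_
    rw [Set.preimage_iUnion, measure_iUnion_null_iff]
    intro j
    rw [Set.preimage_iUnion, measure_iUnion_null_iff]
    intro hj
    have := bisector_null _ habs (xt j) (xt k) (fun h => hj (hinj h))
    rwa [Measure.map_apply hXm
      (isClosed_eq (by fun_prop) (by fun_prop)).measurableSet] at this
  rw [setIntegral_measure_zero _ hnull] at hlim
  filter_upwards [hlim.eventually (gt_mem_nhds hF)] with m hm
  have e1 := integral_sub (i1.sub i2) (i3 m)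
  have e2 := integral_sub i1 i2
  have e3 := integral_indicator (μ := P) (f := fun ω => checkFn α (Y ω - b) + checkFn α (Y ω - qt))
    (hsm m)
  rw [eq m]
  refine lt_of_lt_of_eq ?_ e1.symm
  refine lt_of_lt_of_eq ?_ (congrArg₂ (fun u v => u - v) e2.symm e3.symm)
  exact sub_pos.2 hm

lemma lip_memLp {d : ℕ} {Ω : Type*} [MeasurableSpace Ω] (P : Measure Ω) [IsProbabilityMeasure P]
    (X : Ω → EuclideanSpace ℝ (Fin d)) (hXm : Measurable X) (hX2 : MemLp X 2 P)
    (m : EuclideanSpace ℝ (Fin d) → ℝ) (K : NNReal) (hm : LipschitzWith K m) :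
    MemLp (fun ω => m (X ω)) 2 P := by
  have hb : MemLp (fun ω => |m 0| + (K : ℝ) * ‖X ω‖) 2 P := by
    have h1 : MemLp (fun _ : Ω => |m 0|) 2 P := memLp_const _
    have h2 : MemLp (fun ω => (K : ℝ) * ‖X ω‖) 2 P := hX2.norm.const_mul (K : ℝ)
    exact h1.add h2
  have hmm : Measurable (fun ω => m (X ω)) := hm.continuous.measurable.comp hXm
  refine hb.mono hmm.aestronglyMeasurable ?_
  refine Eventually.of_forall fun ω => ?_
  have h1 := hm.dist_le_mul (X ω) 0
  rw [Real.dist_eq, dist_zero_right] at h1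
  have h2 := abs_sub_abs_le_abs_sub (m (X ω)) (m 0)
  have h3 : 0 ≤ |m 0| + (K : ℝ) * ‖X ω‖ := by positivity
  rw [Real.norm_eq_abs, Real.norm_of_nonneg h3]
  linarith

/-- consistency of the sample quantization-based conditional quantile
estimator.  In the location-scale model `Y = m₁(X) + m₂(X)ε` (with `L₂` moments, `X ⟂ ε`,
absolutely continuous compactly supported law of `X`), let `γ^N = {x̃₁,…,x̃_N}` be an
`L₂`-optimal `N`-grid with positive-mass cells, `x` a point with a unique nearest grid point,
and `q̃` the unique minimizer of `a ↦ G̃_a(x̃)`.  Given i.i.d. copies `(Xᵢ,Yᵢ)` of `(X,Y)` and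
random grids `γ̂ⁿ = (x̂₁ⁿ,…,x̂_Nⁿ)` converging a.s. to `(x̃₁,…,x̃_N)`, any minimizer `q̂_n` of
`a ↦ Σ_{i<n} ρ_α(Yᵢ−a)·1_{Proj_{γ̂ⁿ}(Xᵢ)=Proj_{γ̂ⁿ}(x)}` converges to `q̃` in probability. -/
theorem sample_quantile_consistency {d : ℕ} (hd : 1 ≤ d) (α : ℝ)
    (hα : α ∈ Set.Ioo (0:ℝ) 1) (N : ℕ) (hN : 1 ≤ N)
    {Ω : Type*} [MeasurableSpace Ω] (P : Measure Ω) [IsProbabilityMeasure P]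
    (X : Ω → EuclideanSpace ℝ (Fin d)) (ε : Ω → ℝ) (hXm : Measurable X) (hεm : Measurable ε)
    (hindep : IndepFun X ε P)
    (m₁ m₂ : EuclideanSpace ℝ (Fin d) → ℝ) (K₁ K₂ : NNReal)
    (h₁ : LipschitzWith K₁ m₁) (h₂ : LipschitzWith K₂ m₂) (h₂pos : ∀ x, 0 < m₂ x)
    (hXmom : Integrable (fun ω => ‖X ω‖ ^ (2:ℝ)) P)
    (hεmom : Integrable (fun ω => |ε ω| ^ (2:ℝ)) P)
    (habs : (P.map X).AbsolutelyContinuous volume)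
    (hcomp : IsCompact (msupport (P.map X)))
    (Y : Ω → ℝ) (hY : ∀ ω, Y ω = m₁ (X ω) + m₂ (X ω) * ε ω)
    (x : EuclideanSpace ℝ (Fin d))
    (xt : Fin N → EuclideanSpace ℝ (Fin d))
    (hgrid : IsOptimalGrid (P.map X) 2 N (Finset.image xt Finset.univ))
    (proj : EuclideanSpace ℝ (Fin d) → EuclideanSpace ℝ (Fin d))
    (hproj : IsNearestProj (Finset.image xt Finset.univ) proj)
    (hmass : ∀ c ∈ Finset.image xt Finset.univ, 0 < P {ω | proj (X ω) = c})
    (huniq : ∃! c, c ∈ Finset.image xt Finset.univ ∧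
      ∀ c' ∈ Finset.image xt Finset.univ, dist x c ≤ dist x c')
    (qt : ℝ)
    (hqt : (∀ a : ℝ, Gtil P Y X proj α qt (proj x) ≤ Gtil P Y X proj α a (proj x)) ∧
      ∀ b : ℝ, (∀ a : ℝ, Gtil P Y X proj α b (proj x) ≤ Gtil P Y X proj α a (proj x)) → b = qt)
    (Xs : ℕ → Ω → EuclideanSpace ℝ (Fin d)) (Ys : ℕ → Ω → ℝ)
    (hXsm : ∀ i, Measurable (Xs i)) (hYsm : ∀ i, Measurable (Ys i))
    (hiid : iIndepFun (fun i ω => (Xs i ω, Ys i ω)) P)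
    (hident : ∀ i : ℕ,
      P.map (fun ω => (Xs i ω, Ys i ω)) = P.map (fun ω => (X ω, Y ω)))
    (xh : ℕ → Fin N → Ω → EuclideanSpace ℝ (Fin d))
    (hxhm : ∀ n i, Measurable (xh n i))
    (hxhconv : ∀ᵐ ω ∂P, ∀ i, Filter.Tendsto (fun n => xh n i ω) Filter.atTop (nhds (xt i)))
    (projh : ℕ → Ω → EuclideanSpace ℝ (Fin d) → EuclideanSpace ℝ (Fin d))
    (hprojh : ∀ n ω z, ∃ i, projh n ω z = xh n i ω ∧
      ∀ j, dist z (xh n i ω) ≤ dist z (xh n j ω))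
    (qh : ℕ → Ω → ℝ)
    (hqh : ∀ n ω, ∀ a : ℝ,
      (∑ i ∈ Finset.range n,
          Set.indicator {z | projh n ω z = projh n ω x}
            (fun _ => checkFn α (Ys i ω - qh n ω)) (Xs i ω)) ≤
        ∑ i ∈ Finset.range n,
          Set.indicator {z | projh n ω z = projh n ω x}
            (fun _ => checkFn α (Ys i ω - a)) (Xs i ω)) :
    TendstoInMeasure P (fun n => qh n) Filter.atTop (fun _ => qt) := by
  have hYm : Measurable Y := by
    have : Y = fun ω => m₁ (X ω) + m₂ (X ω) * ε ω := funext hY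
    rw [this]
    exact (h₁.continuous.measurable.comp hXm).add
      ((h₂.continuous.measurable.comp hXm).mul hεm)
  have hX2 : MemLp X 2 P := by
    rw [← memLp_norm_iff hXm.aestronglyMeasurable,
      memLp_two_iff_integrable_sq hXm.norm.aestronglyMeasurable]
    simpa only [Real.rpow_two] using hXmom
  have hε2 : MemLp ε 2 P := by
    rw [memLp_two_iff_integrable_sq hεm.aestronglyMeasurable]
    simpa only [Real.rpow_two, sq_abs] using hεmom
  have hlip : ∀ (m : EuclideanSpace ℝ (Fin d) → ℝ) (K : NNReal), LipschitzWith K m →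
      MemLp (fun ω => m (X ω)) 2 P := by
    intro m K hm
    exact lip_memLp P X hXm hX2 m K hm
  have hYi : Integrable Y P := by
    have : Y = fun ω => m₁ (X ω) + m₂ (X ω) * ε ω := funext hY
    rw [this]
    exact ((hlip m₁ K₁ h₁).integrable (by norm_num)).add
      ((hlip m₂ K₂ h₂).integrable_mul hε2)
  have : IsProbabilityMeasure (P.map X) := Measure.isProbabilityMeasure_map hXm.aemeasurable
  have hmomμ : Integrable (fun z => ‖z‖ ^ (2:ℝ)) (P.map X) := by
    rw [integrable_map_measure _ hXm.aemeasurable]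
    · exact hXmom
    · simp only [Real.rpow_two]
      exact (continuous_norm.pow 2).aestronglyMeasurable
  have hinj := grid_inj hd N (P.map X) hmomμ habs xt hgrid
  have hproj' : ∀ z, ∃ i, proj z = xt i ∧ ∀ j, dist z (xt i) ≤ dist z (xt j) := by
    intro z
    obtain ⟨hm, hdist⟩ := hproj.2 z
    obtain ⟨i, -, hi⟩ := Finset.mem_image.1 hm
    refine ⟨i, hi.symm, fun j => ?_⟩
    rw [hi, hdist]
    exact Metric.infDist_le_dist_of_mem (by simp)
  obtain ⟨k, hk, hkmin⟩ := hproj' x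
  have hmin_of : ∀ i, (∀ j, dist x (xt i) ≤ dist x (xt j)) →
      (xt i ∈ Finset.image xt Finset.univ ∧
        ∀ c' ∈ Finset.image xt Finset.univ, dist x (xt i) ≤ dist x c') := by
    intro i hi
    refine ⟨Finset.mem_image_of_mem _ (Finset.mem_univ _), fun c' hc' => ?_⟩
    obtain ⟨j, -, rfl⟩ := Finset.mem_image.1 hc'
    exact hi j
  have hgap : ∀ j, j ≠ k → dist x (xt k) < dist x (xt j) := by
    intro j hj
    refine lt_of_le_of_ne (hkmin j) fun h => hj (hinj ?_)
    exact huniq.unique (hmin_of j fun l => h ▸ hkmin l) (hmin_of k hkmin)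
  rw [hk] at hqt
  have hstrict : ∀ b, b ≠ qt → Gtil P Y X proj α qt (xt k) < Gtil P Y X proj α b (xt k) := by
    intro b hb
    by_contra hcon
    exact hb (hqt.2 b fun a => (not_lt.1 hcon).trans (hqt.1 a))
  have hmassk := hmass (xt k) (Finset.mem_image_of_mem _ (Finset.mem_univ _))
  rw [tendstoInMeasure_iff_dist]
  intro e he
  have hgap' : ∀ᶠ m : ℕ in atTop, ∀ j, j ≠ k →
      dist x (xt k) + 1 / ((m : ℝ) + 1) < dist x (xt j) := by
    refine eventually_all.2 fun j => ?_
    by_cases hj : j = k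
    · exact Eventually.of_forall fun m h => absurd hj h
    · filter_upwards [(tendsto_one_div_add_atTop_nhds_zero_nat (𝕜 := ℝ)).eventually
        (gt_mem_nhds (sub_pos.2 (hgap j hj)))] with m hm _
      linarith
  obtain ⟨hip, hpp⟩ := gcomp_pos P hα X Y hXm hYi habs xt hinj k proj hproj.1 hmassk qt (qt + e)
    (hstrict _ (by intro h; linarith))
  obtain ⟨him, hpm⟩ := gcomp_pos P hα X Y hXm hYi habs xt hinj k proj hproj.1 hmassk qt (qt - e)
    (hstrict _ (by intro h; linarith))
  obtain ⟨m, hgm, hppm, hpmm⟩ := (hgap'.and (hpp.and hpm)).exists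
  have hδ : (0:ℝ) < 1 / ((m : ℝ) + 1) := by positivity
  replace hip := hip m
  replace him := him m
  generalize 1 / ((m : ℝ) + 1) = δ at hgm hppm hpmm hδ hip him
  set A : Set (EuclideanSpace ℝ (Fin d)) := {z | proj z = xt k} with hAdef
  set B := blayer xt k δ
  have hA : MeasurableSet A := hproj.1 (measurableSet_singleton _)
  have hB : MeasurableSet B := blayer_meas _ _ _
  have hgmeas := fun b => gcomp_meas α hA hB qt b
  have s1 := slln_pos P X Y hXm hYm Xs Ys hXsm hYsm hiid hident _ (hgmeas (qt + e)) hip hppm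
  have s2 := slln_pos P X Y hXm hYm Xs Ys hXsm hYsm hiid hident _ (hgmeas (qt - e)) him hpmm
  let G : ℕ → Set Ω := fun n => (⋂ i, {ω | dist (xh n i ω) (xt i) < δ / 4}) ∩
    ({ω | 0 < ∑ i ∈ Finset.range n, gcomp α A B qt (qt + e) (Xs i ω, Ys i ω)} ∩
     {ω | 0 < ∑ i ∈ Finset.range n, gcomp α A B qt (qt - e) (Xs i ω, Ys i ω)})
  have hsum : ∀ n b, Measurable
      (fun ω => ∑ i ∈ Finset.range n, gcomp α A B qt b (Xs i ω, Ys i ω)) := fun n b =>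
    Finset.measurable_sum _ fun i _ => (hgmeas b).comp ((hXsm i).prodMk (hYsm i))
  have hGm : ∀ n, MeasurableSet (G n) := by
    intro n
    refine (MeasurableSet.iInter fun i => ?_).inter (MeasurableSet.inter ?_ ?_)
    · exact measurableSet_lt ((hxhm n i).dist measurable_const) measurable_const
    · exact measurableSet_lt measurable_const (hsum n _)
    · exact measurableSet_lt measurable_const (hsum n _)
  have hlim : Tendsto (fun n => P (G n)ᶜ) atTop (nhds (P ∅)) := by
    refine tendsto_measure_of_ae_tendsto_indicator_of_isFiniteMeasure atTop
      MeasurableSet.empty (fun n => (hGm n).compl) ?_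
    filter_upwards [s1, s2, hxhconv] with ω w1 w2 w3
    have w4 : ∀ᶠ n in atTop, ∀ i, dist (xh n i ω) (xt i) < δ / 4 :=
      eventually_all.2 fun i => (Metric.tendsto_nhds.1 (w3 i)) _ (by positivity)
    filter_upwards [w1, w2, w4] with n v1 v2 v4
    simp only [Set.mem_empty_iff_false, iff_false, Set.mem_compl_iff, not_not]
    exact ⟨Set.mem_iInter.2 v4, v1, v2⟩
  rw [measure_empty] at hlim
  refine tendsto_of_tendsto_of_tendsto_of_le_of_le tendsto_const_nhds hlim
    (fun n => zero_le) (fun n => measure_mono ?_)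
  intro ω hω hG
  obtain ⟨g1, g2, g3⟩ := hG
  have g1' : ∀ i, dist (xh n i ω) (xt i) < δ / 4 := by
    intro i
    have := Set.mem_iInter.1 g1 i
    exact this
  have hω' : e ≤ dist (qh n ω) qt := hω
  refine absurd hω' (not_le.2 ?_)
  refine min_close hα A B {z | projh n ω z = projh n ω x} qt e (qh n ω) he n
    (fun i => Xs i ω) (fun i => Ys i ω) ?_ (hqh n ω) g2 g3
  intro z hz
  exact cell_stable xt (fun i => xh n i ω) k δ proj (projh n ω) hproj' (hprojh n ω)
    g1' x z hgm hz
end
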